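/- arXiv:math/9901072 — 4 statements merged into one kernel-verified Lean document; each statement's English description precedes it below -/
import Mathlib

section
/- If A is a square-zero endomorphism of H of rank t, then the centralizer {X ∈ End_K(H) : X ∘ A = A ∘ X}, which is a K-subspace of End_K(H), has dimension t² + (h−t)². (Consequently the conjugation orbit N^t of A has dimension h² − t² − (h−t)² = 2t(h−t), the dimension of the cotangent bundle T*G(t,H) of the Grassmannian, as required for T*G(t,H) → N̄^t to be a resolution.) -/
/-- The centralizer of `A` in `End K H`, as a subspace. -/
def endCentralizer {K H : Type*} [Field K] [AddCommGroup H] [Module K H] (A : H →ₗ[K] H) :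
    Submodule K (H →ₗ[K] H) where
  carrier := {X | X ∘ₗ A = A ∘ₗ X}
  add_mem' {X Y} hX hY := by
    simp only [Set.mem_ofPred_eq] at *
    rw [LinearMap.add_comp, LinearMap.comp_add, hX, hY]
  zero_mem' := by simp
  smul_mem' c X hX := by
    simp only [Set.mem_ofPred_eq] at *
    rw [LinearMap.smul_comp, LinearMap.comp_smul, hX]

section

variable {K H : Type*} [Field K] [AddCommGroup H] [Module K H] {A : H →ₗ[K] H}

theorem mem_endCentralizer {X : H →ₗ[K] H} :
    X ∈ endCentralizer A ↔ X ∘ₗ A = A ∘ₗ X := Iff.rfl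

/-- An element of the centralizer of `A` restricts to the range of `A`. -/
def endCentralizerRestrictRange (A : H →ₗ[K] H) :
    endCentralizer A →ₗ[K] (LinearMap.range A →ₗ[K] LinearMap.range A) where
  toFun X := X.1.restrict (p := LinearMap.range A) (q := LinearMap.range A) (by
    rintro _ ⟨y, rfl⟩
    exact ⟨X.1 y, (LinearMap.congr_fun X.2 y).symm⟩)
  map_add' _ _ := rfl
  map_smul' _ _ := rfl

/-- A map `H ⧸ range A → ker A` induces an endomorphism of `H` whose composites with `A` on both
sides vanish. -/
def endCentralizerOfQuotient (A : H →ₗ[K] H) :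
    ((H ⧸ LinearMap.range A) →ₗ[K] LinearMap.ker A) →ₗ[K] endCentralizer A where
  toFun f := ⟨(LinearMap.ker A).subtype ∘ₗ f ∘ₗ (LinearMap.range A).mkQ, by
    rw [mem_endCentralizer]
    ext x
    have h : (LinearMap.range A).mkQ (A x) = 0 := by simp
    simp only [LinearMap.comp_apply, h, map_zero, Submodule.subtype_apply]
    exact (f ((LinearMap.range A).mkQ x)).2.symm⟩
  map_add' _ _ := rfl
  map_smul' _ _ := rfl

theorem endCentralizerOfQuotient_injective :
    Function.Injective (endCentralizerOfQuotient A) := by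
  intro f g hfg
  ext x
  exact LinearMap.congr_fun (congrArg Subtype.val hfg) x

theorem range_endCentralizerOfQuotient :
    LinearMap.range (endCentralizerOfQuotient A) =
      LinearMap.ker (endCentralizerRestrictRange A) := by
  ext X
  constructor
  · rintro ⟨f, rfl⟩
    rw [LinearMap.mem_ker]
    ext ⟨_, y, rfl⟩
    have h : (LinearMap.range A).mkQ (A y) = 0 := by simp
    change ((f ((LinearMap.range A).mkQ (A y)) : LinearMap.ker A) : H) = 0
    rw [h, map_zero, Submodule.coe_zero]
  · intro hX
    have hXA (y : H) : X.1 (A y) = 0 :=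
      congrArg Subtype.val (LinearMap.congr_fun hX ⟨A y, y, rfl⟩)
    have hAX (y : H) : A (X.1 y) = 0 := (LinearMap.congr_fun X.2 y).symm.trans (hXA y)
    refine ⟨(LinearMap.range A).liftQ (X.1.codRestrict (LinearMap.ker A) hAX) ?_, ?_⟩
    · rintro _ ⟨y, rfl⟩
      exact Subtype.ext (hXA y)
    · rfl

theorem endCentralizerRestrictRange_surjective (hA : A ∘ₗ A = 0) :
    Function.Surjective (endCentralizerRestrictRange A) := by
  intro f
  obtain ⟨s, hs⟩ := A.rangeRestrict.exists_rightInverse_of_surjective A.range_rangeRestrict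
  obtain ⟨p, hp⟩ := (LinearMap.range A).subtype.exists_leftInverse_of_injective
    (LinearMap.range A).ker_subtype
  have hAs (r : LinearMap.range A) : A (s r) = r :=
    congrArg Subtype.val (LinearMap.congr_fun hs r)
  have hpr (r : LinearMap.range A) : p r = r := LinearMap.congr_fun hp r
  have hAA (y : H) : A (A y) = 0 := LinearMap.congr_fun hA y
  have hAr (r : LinearMap.range A) : A r = 0 := by
    obtain ⟨_, y, rfl⟩ := r
    exact hAA y
  have hrr (r : LinearMap.range A) : A.rangeRestrict r = 0 := Subtype.ext (hAr r)
  let X : H →ₗ[K] H := s ∘ₗ f ∘ₗ A.rangeRestrict +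
    (LinearMap.range A).subtype ∘ₗ f ∘ₗ p ∘ₗ (LinearMap.id - s ∘ₗ A.rangeRestrict)
  have hXr (r : LinearMap.range A) : X r = f r := by
    simp [X, hrr, hpr]
  refine ⟨⟨X, mem_endCentralizer.2 ?_⟩, ?_⟩
  · ext y
    refine (hXr (A.rangeRestrict y)).trans ?_
    simp only [X, LinearMap.comp_apply, LinearMap.add_apply, map_add, hAs,
      Submodule.subtype_apply, hAr, add_zero]
  · ext r
    exact hXr r

theorem finrank_endCentralizer [FiniteDimensional K H] (hA : A ∘ₗ A = 0) :
    Module.finrank K (endCentralizer A) = Module.finrank K (LinearMap.range A) ^ 2 +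
      (Module.finrank K H - Module.finrank K (LinearMap.range A)) ^ 2 := by
  have hker := LinearMap.finrank_range_add_finrank_ker A
  have hquot := (LinearMap.range A).finrank_quotient_add_finrank
  rw [← LinearMap.finrank_range_add_finrank_ker (endCentralizerRestrictRange A),
    LinearMap.range_eq_top.2 (endCentralizerRestrictRange_surjective hA), finrank_top,
    ← range_endCentralizerOfQuotient,
    LinearMap.finrank_range_of_inj endCentralizerOfQuotient_injective,
    Module.finrank_linearMap, Module.finrank_linearMap, sq, sq]
  congr 2 <;> omega

end

/-- If `A` is a square-zero endomorphism of a finite-dimensional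
vector space `H` (of dimension `h`) of rank `t`, then the centralizer
`{X ∈ End_K(H) : X ∘ A = A ∘ X}`, which is a `K`-subspace of `End_K(H)`,
has dimension `t² + (h − t)²`. -/
theorem stmt_3 (K : Type*) [Field K] (H : Type*) [AddCommGroup H] [Module K H]
    [FiniteDimensional K H] (A : H →ₗ[K] H) (hA : A ∘ₗ A = 0) (t : ℕ)
    (ht : Module.finrank K (LinearMap.range A) = t) :
    ∃ C : Submodule K (H →ₗ[K] H),
      (∀ X : H →ₗ[K] H, X ∈ C ↔ X ∘ₗ A = A ∘ₗ X) ∧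
      Module.finrank K C = t ^ 2 + (Module.finrank K H - t) ^ 2 := by
  exact ⟨endCentralizer A, fun _ => mem_endCentralizer, ht ▸ finrank_endCentralizer hA⟩
end

section
/- Setting σ' = T₁ ∘ σ ∘ T₋₁ and τ' = T₁ ∘ τ ∘ T₋₁, one has the equality of ℤ-linear automorphisms of ℤ³: σ' ∘ τ' ∘ σ ∘ τ = T₂. (This is the paper's relation O(2) = σ'τ'στ, showing that tensorization by O(2) lies in the reflection subgroup W generated by ±2-reflections of the Mukai lattice.) -/
/-- The algebraic Mukai lattice `ℤ³`, with coordinates `(r, d, s)`. -/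
abbrev MV : Type := ℤ × ℤ × ℤ

/-- The Mukai pairing on `ℤ³` for a K3 surface of genus `g`:
`⟨(r,d,s),(r',d',s')⟩ = (2g−2)·d·d' − r·s' − r'·s`. -/
def mukaiPair (g : ℤ) (v w : MV) : ℤ :=
  (2 * g - 2) * (v.2.1 * w.2.1) - v.1 * w.2.2 - w.1 * v.2.2

/-- The reflection `σ(r,d,s) = (s,d,r)` as a `ℤ`-linear automorphism of `ℤ³`. -/
def mSigma : MV ≃ₗ[ℤ] MV where
  toFun v := (v.2.2, v.2.1, v.1)
  invFun v := (v.2.2, v.2.1, v.1)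
  map_add' _ _ := rfl
  map_smul' _ _ := rfl
  left_inv _ := rfl
  right_inv _ := rfl

/-- The reflection `τ(r,d,s) = (−s,d,−r)` as a `ℤ`-linear automorphism of `ℤ³`. -/
def mTau : MV ≃ₗ[ℤ] MV where
  toFun v := (-v.2.2, v.2.1, -v.1)
  invFun v := (-v.2.2, v.2.1, -v.1)
  map_add' x y := by
    obtain ⟨a, b, c⟩ := x; obtain ⟨a', b', c'⟩ := y
    simp only [Prod.mk_add_mk, Prod.mk.injEq]
    refine ⟨?_, ?_, ?_⟩ <;> first | trivial | ring
  map_smul' r x := by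
    obtain ⟨a, b, c⟩ := x
    simp only [Prod.smul_mk, smul_eq_mul, RingHom.id_apply, Prod.mk.injEq]
    refine ⟨?_, ?_, ?_⟩ <;> first | trivial | ring
  left_inv x := by obtain ⟨a, b, c⟩ := x; simp
  right_inv x := by obtain ⟨a, b, c⟩ := x; simp

/-- Tensorization by `L^⊗k`:
`T_k(r,d,s) = (r, d + k·r, s + (g−1)·(2·k·d + k²·r))`, as a `ℤ`-linear automorphism. -/
def mTensor (g k : ℤ) : MV ≃ₗ[ℤ] MV where
  toFun v := (v.1, v.2.1 + k * v.1, v.2.2 + (g - 1) * (2 * k * v.2.1 + k ^ 2 * v.1))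
  invFun v := (v.1, v.2.1 - k * v.1, v.2.2 + (g - 1) * (-(2 * k) * v.2.1 + k ^ 2 * v.1))
  map_add' x y := by
    obtain ⟨a, b, c⟩ := x; obtain ⟨a', b', c'⟩ := y
    simp only [Prod.mk_add_mk, Prod.mk.injEq]
    refine ⟨?_, ?_, ?_⟩ <;> first | trivial | ring
  map_smul' r x := by
    obtain ⟨a, b, c⟩ := x
    simp only [Prod.smul_mk, smul_eq_mul, RingHom.id_apply, Prod.mk.injEq]
    refine ⟨?_, ?_, ?_⟩ <;> first | trivial | ring
  left_inv x := by
    obtain ⟨a, b, c⟩ := x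
    simp only [Prod.mk.injEq]
    refine ⟨?_, ?_, ?_⟩ <;> first | trivial | ring
  right_inv x := by
    obtain ⟨a, b, c⟩ := x
    simp only [Prod.mk.injEq]
    refine ⟨?_, ?_, ?_⟩ <;> first | trivial | ring

/-- An isometry of the Mukai pairing: a `ℤ`-linear automorphism of `ℤ³`
preserving the form. -/
def IsMukaiIsometry (g : ℤ) (f : MV ≃ₗ[ℤ] MV) : Prop :=
  ∀ v w : MV, mukaiPair g (f v) (f w) = mukaiPair g v w

/-- Setting σ' = T₁ ∘ σ ∘ T₋₁ and τ' = T₁ ∘ τ ∘ T₋₁, one has the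
equality of ℤ-linear automorphisms of ℤ³: σ' ∘ τ' ∘ σ ∘ τ = T₂.  (The paper's relation
O(2) = σ'τ'στ, showing that tensorization by O(2) lies in the reflection subgroup
generated by ±2-reflections of the Mukai lattice.) -/
theorem stmt_12 (g : ℤ) (hg : 2 ≤ g) :
    ((mTau.trans mSigma).trans
        (((mTensor g (-1)).trans (mTau.trans (mTensor g 1))).trans
          ((mTensor g (-1)).trans (mSigma.trans (mTensor g 1))))) = mTensor g 2 := by
  ext v
  all_goals simp [mSigma, mTau, mTensor]
  all_goals ring
end

section
/- Assume g ≥ 3. For every γ ∈ Γ, writing γ(0,0,1) = (r,d,s), either (g−1) divides r and gcd(g−1, s) = 1, or (g−1) divides s and gcd(g−1, r) = 1. (In particular, since g−1 ≥ 2, the integer g−1 divides exactly one of the two integers r, s and is relatively prime to the other; this is the invariant the paper uses to show Γ is a proper subgroup of the isometry group.) -/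
/-- Negation `−Id` as a ℤ-linear automorphism of ℤ³. -/
def mNeg : MV ≃ₗ[ℤ] MV where
  toFun v := -v
  invFun v := -v
  map_add' x y := by abel
  map_smul' r x := by simp
  left_inv x := by simp
  right_inv x := by simp

/-- The subgroup Γ of the group of ℤ-linear automorphisms of ℤ³ generated by
−Id, σ, τ, and the tensorizations T_k for all k ∈ ℤ. -/
def mGamma (g : ℤ) : Subgroup (MV ≃ₗ[ℤ] MV) :=
  Subgroup.closure ({mNeg, mSigma, mTau} ∪ Set.range (mTensor g))

/-- The integer `n` divides one of the outer coordinates `r`, `s` of `v = (r,d,s)` and is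
relatively prime to the other. -/
def DvdCoprimeEnds (n : ℤ) (v : MV) : Prop :=
  (n ∣ v.1 ∧ Int.gcd n v.2.2 = 1) ∨ (n ∣ v.2.2 ∧ Int.gcd n v.1 = 1)

theorem dvdCoprimeEnds_mNeg (n : ℤ) (v : MV) :
    DvdCoprimeEnds n (mNeg v) ↔ DvdCoprimeEnds n v := by
  change (n ∣ -v.1 ∧ Int.gcd n (-v.2.2) = 1) ∨ (n ∣ -v.2.2 ∧ Int.gcd n (-v.1) = 1) ↔ _
  simp only [DvdCoprimeEnds, dvd_neg, Int.gcd_neg]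

theorem dvdCoprimeEnds_mSigma (n : ℤ) (v : MV) :
    DvdCoprimeEnds n (mSigma v) ↔ DvdCoprimeEnds n v :=
  or_comm

theorem dvdCoprimeEnds_mTau (n : ℤ) (v : MV) :
    DvdCoprimeEnds n (mTau v) ↔ DvdCoprimeEnds n v :=
  (dvdCoprimeEnds_mNeg n (mSigma v)).trans (dvdCoprimeEnds_mSigma n v)

theorem dvdCoprimeEnds_mTensor (g k : ℤ) (v : MV) :
    DvdCoprimeEnds (g - 1) (mTensor g k v) ↔ DvdCoprimeEnds (g - 1) v := by
  simp [DvdCoprimeEnds, mTensor]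

theorem dvdCoprimeEnds_of_mem_mGamma {g : ℤ} {γ : MV ≃ₗ[ℤ] MV} (hγ : γ ∈ mGamma g) (v : MV) :
    DvdCoprimeEnds (g - 1) (γ v) ↔ DvdCoprimeEnds (g - 1) v := by
  induction hγ using Subgroup.closure_induction generalizing v with
  | mem f hf =>
    rcases hf with (rfl | rfl | rfl) | ⟨k, rfl⟩
    · exact dvdCoprimeEnds_mNeg _ v
    · exact dvdCoprimeEnds_mSigma _ v
    · exact dvdCoprimeEnds_mTau _ v
    · exact dvdCoprimeEnds_mTensor g k v
  | one => rfl
  | mul f f' _ _ hf hf' => exact (hf (f' v)).trans (hf' v)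
  | inv f _ hf =>
    rw [← hf (f⁻¹ v)]
    exact iff_of_eq (congrArg _ (f.apply_symm_apply v))

/-- Assume g ≥ 3.  For every γ ∈ Γ, writing γ(0,0,1) = (r,d,s),
either (g−1) divides r and gcd(g−1, s) = 1, or (g−1) divides s and gcd(g−1, r) = 1.
(Since g−1 ≥ 2, the integer g−1 divides exactly one of r, s and is relatively prime to
the other: the invariant used to show Γ is a proper subgroup of the isometry group.) -/
theorem stmt_14 (g : ℤ) (hg : 3 ≤ g) (γ : MV ≃ₗ[ℤ] MV) (hγ : γ ∈ mGamma g) :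
    ((g - 1) ∣ (γ ((0, 0, 1) : MV)).1 ∧ Int.gcd (g - 1) (γ ((0, 0, 1) : MV)).2.2 = 1) ∨
    ((g - 1) ∣ (γ ((0, 0, 1) : MV)).2.2 ∧ Int.gcd (g - 1) (γ ((0, 0, 1) : MV)).1 = 1) :=
  (dvdCoprimeEnds_of_mem_mGamma hγ (0, 0, 1)).2 (Or.inl ⟨dvd_zero _, Int.gcd_one_right _⟩)
end

section
/- Take g = 7, and let M be the ℤ-linear automorphism of ℤ³ given by M(r,d,s) = (2r + 12d + 3s, r + 5d + s, 3r + 12d + 2s). Then M does not belong to the subgroup Γ. (Indeed M(0,0,1) = (3,1,2), and g−1 = 6 divides neither 3 nor 2, violating the divisibility invariant satisfied by every element of the orbit Γ·(0,0,1); thus this isometry of the Mukai pairing for g = 7 is not in the subgroup generated by −Id, σ, τ and the tensorizations.) -/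
/-- The ℤ-linear automorphism M(r,d,s) = (2r + 12d + 3s, r + 5d + s, 3r + 12d + 2s). -/
def mM : MV ≃ₗ[ℤ] MV where
  toFun v := (2 * v.1 + 12 * v.2.1 + 3 * v.2.2,
              v.1 + 5 * v.2.1 + v.2.2,
              3 * v.1 + 12 * v.2.1 + 2 * v.2.2)
  invFun v := (2 * v.1 - 12 * v.2.1 + 3 * v.2.2,
               -v.1 + 5 * v.2.1 - v.2.2,
               3 * v.1 - 12 * v.2.1 + 2 * v.2.2)
  map_add' x y := by
    obtain ⟨a, b, c⟩ := x; obtain ⟨a', b', c'⟩ := y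
    simp only [Prod.mk_add_mk, Prod.mk.injEq]
    refine ⟨?_, ?_, ?_⟩ <;> first | trivial | ring
  map_smul' r x := by
    obtain ⟨a, b, c⟩ := x
    simp only [Prod.smul_mk, smul_eq_mul, RingHom.id_apply, Prod.mk.injEq]
    refine ⟨?_, ?_, ?_⟩ <;> first | trivial | ring
  left_inv x := by
    obtain ⟨a, b, c⟩ := x
    simp only [Prod.mk.injEq]
    refine ⟨?_, ?_, ?_⟩ <;> first | trivial | ring
  right_inv x := by
    obtain ⟨a, b, c⟩ := x
    simp only [Prod.mk.injEq]
    refine ⟨?_, ?_, ?_⟩ <;> first | trivial | ring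

/-- Every element of `Γ` preserves the condition that `g − 1` divides `r` or `s`. -/
theorem dvd_fst_or_dvd_snd_iff_of_mem_mGamma {g : ℤ} {f : MV ≃ₗ[ℤ] MV} (hf : f ∈ mGamma g)
    (v : MV) :
    (g - 1 ∣ (f v).1 ∨ g - 1 ∣ (f v).2.2) ↔ (g - 1 ∣ v.1 ∨ g - 1 ∣ v.2.2) := by
  induction hf using Subgroup.closure_induction generalizing v with
  | mem x hx =>
    obtain (rfl | rfl | rfl) | ⟨k, rfl⟩ := hx
    · simp [mNeg]
    · simp [mSigma, or_comm]
    · simp [mTau, or_comm]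
    · simp [mTensor]
  | one => rfl
  | mul x y _ _ hx hy => exact (hx (y v)).trans (hy v)
  | inv x _ hx =>
    simpa using (hx (x⁻¹ v)).symm.trans (by rw [← LinearEquiv.mul_apply, mul_inv_cancel]; rfl)

/-- Take g = 7 and let M be the ℤ-linear automorphism of ℤ³ given by
M(r,d,s) = (2r + 12d + 3s, r + 5d + s, 3r + 12d + 2s).  Then M does not belong to the
subgroup Γ generated by −Id, σ, τ and the tensorizations.  (Indeed M(0,0,1) = (3,1,2),
and g−1 = 6 divides neither 3 nor 2, violating the divisibility invariant of the orbit
Γ·(0,0,1).) -/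
theorem stmt_15 : mM ∉ mGamma 7 := by
  intro h
  have := dvd_fst_or_dvd_snd_iff_of_mem_mGamma h (0, 0, 1)
  norm_num [mM] at this
end
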